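/- Suppose f satisfies (A2), with x* the unique global minimum from (A2.1)–(A2.2). Then there is an open neighborhood U ⊆ ℝ^n of x* such that whenever Behavior (B1) holds for a quasi-Newton sequence (x^k) with initial point x^0 ∈ U, the limit x̄ of (x^k) is a Clarke critical point of f, i.e., 0 ∈ conv{∇f_i(x̄) : i ∈ I_e(x̄)}. -/

import Mathlib

open Filter Topology Matrix RealInnerProductSpace

noncomputable section

/-- Euclidean space ℝ^n. -/
abbrev Euc (n : ℕ) := EuclideanSpace ℝ (Fin n)

/-- Assumption (A1): `f` is a continuous selection of the `C¹` functions `φ i`,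
whose gradients are locally Lipschitz continuous. -/
def A1 {n m : ℕ} (f : Euc n → ℝ) (φ : Fin m → Euc n → ℝ) : Prop :=
  Continuous f ∧ (∀ x, ∃ i, f x = φ i x) ∧
    ∀ i, ContDiff ℝ 1 (φ i) ∧ LocallyLipschitz (gradient (φ i))

/-- The essentially active set `I_e(x)`. -/
def Ie {n m : ℕ} (f : Euc n → ℝ) (φ : Fin m → Euc n → ℝ) (x : Euc n) : Set (Fin m) :=
  {i | x ∈ closure (interior {y | f y = φ i y})}

/-- The set `I_g(x)` of essentially active indices whose gradient coincides with `∇f(x)`. -/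
def Ig {n m : ℕ} (f : Euc n → ℝ) (φ : Fin m → Euc n → ℝ) (x : Euc n) : Set (Fin m) :=
  {i | i ∈ Ie f φ x ∧ gradient f x = gradient (φ i) x}

/-- The space `N(x̄) = span{∇f_i(x̄) − ∇f_1(x̄) : i ∈ I}`. -/
def NSpace {n m : ℕ} [NeZero m] (φ : Fin m → Euc n → ℝ) (x : Euc n) : Submodule ℝ (Euc n) :=
  Submodule.span ℝ (Set.range fun i : Fin m => gradient (φ i) x - gradient (φ 0) x)

/-- `t` satisfies the Wolfe conditions at `x` in direction `p`. -/
def WolfeStep {n : ℕ} (f : Euc n → ℝ) (c1 c2 : ℝ) (x p : Euc n) (t : ℝ) : Prop :=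
  DifferentiableAt ℝ f (x + t • p) ∧
  f (x + t • p) ≤ f x + c1 * t * ⟪gradient f x, p⟫ ∧
  c2 * ⟪gradient f x, p⟫ ≤ ⟪gradient f (x + t • p), p⟫

/-- Behavior (B1). -/
def B1 {n m : ℕ} [NeZero m] (f : Euc n → ℝ) (φ : Fin m → Euc n → ℝ) (c1 c2 : ℝ)
    (x : ℕ → Euc n) (H : ℕ → Matrix (Fin n) (Fin n) ℝ) (t : ℕ → ℝ) (xbar : Euc n) : Prop :=
  (0 < c1 ∧ c1 < c2 ∧ c2 < 1) ∧
  (∀ k, (H k).IsSymm ∧ (H k).PosDef) ∧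
  (∀ k, x (k+1) = x k + t k • (-(Matrix.toEuclideanLin (H k) (gradient f (x k))))) ∧
  (∀ k, 0 < t k ∧
    WolfeStep f c1 c2 (x k) (-(Matrix.toEuclideanLin (H k) (gradient f (x k)))) (t k)) ∧
  (∀ k, DifferentiableAt ℝ f (x k) ∧ gradient f (x k) ≠ 0) ∧
  Tendsto x atTop (𝓝 xbar) ∧
  (∀ i : Fin m, {k | i ∈ Ig f φ (x k)}.Infinite) ∧
  (∃ σL σU : ℝ, 0 < σL ∧ σL ≤ σU ∧ ∀ k,
    (∀ v : Euc n, ⟪v, Matrix.toEuclideanLin (H k) v⟫ ≤ σU * ‖v‖ ^ 2) ∧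
    (∃ W : Submodule ℝ (Euc n),
      Module.finrank ℝ W = n - Module.finrank ℝ (NSpace φ xbar) ∧
      ∀ v ∈ W, σL * ‖v‖ ^ 2 ≤ ⟪v, Matrix.toEuclideanLin (H k) v⟫)) ∧
  (∀ i : Fin m, Tendsto
    (fun k => Matrix.toEuclideanLin (H k) (gradient (φ i) xbar - gradient (φ 0) xbar))
    atTop (𝓝 0))

/-- Assumption (A2.1): at `x*` there is a strictly positive vanishing convex-type
combination of the gradients `∇f_i(x*)`, and these gradients are affinely independent. -/
def A21 {n m : ℕ} (φ : Fin m → Euc n → ℝ) (xstar : Euc n) : Prop :=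
  (∃ α : Fin m → ℝ, (∀ i, 0 < α i) ∧ ∑ i, α i • gradient (φ i) xstar = 0) ∧
  AffineIndependent ℝ (fun i : Fin m => gradient (φ i) xstar)

/-- Assumption (A2.2): `x*` is the unique global minimum of `f` and some sublevel set
`{x | f x ≤ f z}` with `z ≠ x*` is bounded. -/
def A22 {n : ℕ} (f : Euc n → ℝ) (xstar : Euc n) : Prop :=
  (∀ x, x ≠ xstar → f xstar < f x) ∧
  ∃ z : Euc n, z ≠ xstar ∧ Bornology.IsBounded {x : Euc n | f x ≤ f z}

section GradientSelection

variable {E : Type*} [NormedAddCommGroup E] [InnerProductSpace ℝ E] [CompleteSpace E]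

/-- Directional derivatives along lines are given by the gradient. -/
theorem hasDerivAt_comp_line_of_differentiableAt {f : E → ℝ} {x : E}
    (hf : DifferentiableAt ℝ f x) (d : E) :
    HasDerivAt (fun s : ℝ => f (x + s • d)) ⟪gradient f x, d⟫ 0 := by
  have hline : HasDerivAt (fun s : ℝ => x + s • d) d 0 := by
    simpa using ((hasDerivAt_id (0 : ℝ)).smul_const d).const_add x
  have hgrad : HasFDerivAt f (InnerProductSpace.toDual ℝ E (gradient f x)) (x + (0 : ℝ) • d) := by
    simpa using hf.hasGradientAt.hasFDerivAt
  exact hgrad.comp_hasDerivAt (0 : ℝ) hline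

/-- At a point of differentiability, the gradient of a selection of finitely many
differentiable functions is the gradient of one of them. -/
theorem exists_gradient_eq_of_selection {ι : Type*} [Finite ι] {f : E → ℝ} {φ : ι → E → ℝ}
    {x : E} (hsel : ∀ y, ∃ i, f y = φ i y) (hf : DifferentiableAt ℝ f x)
    (hφ : ∀ i, DifferentiableAt ℝ (φ i) x) :
    ∃ i, gradient f x = gradient (φ i) x := by
  have hcover : ⋃ i, ((ℝ ∙ (gradient f x - gradient (φ i) x))ᗮ : Set E) = Set.univ := by
    refine Set.eq_univ_of_forall fun d => ?_
    by_contra hd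
    simp only [Set.mem_iUnion, SetLike.mem_coe, Submodule.mem_orthogonal_singleton_iff_inner_right,
      not_exists] at hd
    have hne : ∀ i, ∀ᶠ s in 𝓝[≠] (0 : ℝ), f (x + s • d) - φ i (x + s • d) ≠ 0 := fun i => by
      refine ((hasDerivAt_comp_line_of_differentiableAt hf d).sub
        (hasDerivAt_comp_line_of_differentiableAt (hφ i) d)).eventually_ne ?_
      rw [← inner_sub_left]
      exact hd i
    obtain ⟨s, hs⟩ := (eventually_all.2 hne).exists
    obtain ⟨i, hi⟩ := hsel (x + s • d)
    exact hs i (sub_eq_zero.2 hi)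
  obtain ⟨i, hi⟩ := Subspace.exists_eq_top_of_iUnion_eq_univ hcover
  refine ⟨i, sub_eq_zero.1 ?_⟩
  rwa [Submodule.orthogonal_eq_top_iff, Submodule.span_singleton_eq_bot] at hi

end GradientSelection

section QuadraticForm

variable {E : Type*} [NormedAddCommGroup E] [InnerProductSpace ℝ E]

/-- A positive operator whose quadratic form is at most `σ ‖v‖ ^ 2` has norm at most `σ`. -/
theorem LinearMap.IsPositive.norm_apply_le {T : E →ₗ[ℝ] E} (hT : T.IsPositive) {σ : ℝ}
    (hσ : 0 < σ) (hupper : ∀ v, ⟪v, T v⟫ ≤ σ * ‖v‖ ^ 2) (v : E) : ‖T v‖ ≤ σ * ‖v‖ := by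
  have hpos : 0 ≤ ⟪T v - σ • v, T (T v - σ • v)⟫ := by
    simpa using hT.re_inner_nonneg_right (T v - σ • v)
  have hsymm : ⟪v, T (T v)⟫ = ‖T v‖ ^ 2 := by
    rw [← hT.isSymmetric, real_inner_self_eq_norm_sq]
  simp only [map_sub, map_smul, inner_sub_left, inner_sub_right, inner_smul_left,
    inner_smul_right, real_inner_self_eq_norm_sq, hsymm, conj_trivial] at hpos
  have h₁ := hupper (T v)
  have h₂ := hupper v
  refine abs_le_of_sq_le_sq' ?_ (by positivity) |>.2
  have h₃ : σ * ‖T v‖ ^ 2 ≤ σ * (σ * ⟪v, T v⟫) := by nlinarith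
  have h₄ := le_of_mul_le_mul_left h₃ hσ
  nlinarith [mul_le_mul_of_nonneg_left h₂ hσ.le]

/-- If `T` is uniformly positive on a subspace of dimension complementary to that of `N`
and small on `N`, then `T` is uniformly positive on the orthogonal complement of `N`. -/
theorem LinearMap.IsSymmetric.le_inner_apply_of_mem_orthogonal [FiniteDimensional ℝ E]
    {T : E →ₗ[ℝ] E} (hT : T.IsSymmetric) {N W : Submodule ℝ E} {σ ε : ℝ}
    (hW : Module.finrank ℝ W = Module.finrank ℝ E - Module.finrank ℝ N)
    (hlower : ∀ w ∈ W, σ * ‖w‖ ^ 2 ≤ ⟪w, T w⟫) (hε : 0 ≤ ε) (hεσ : 2 * ε < σ)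
    (hN : ∀ v ∈ N, ‖T v‖ ≤ ε * ‖v‖) {g : E} (hg : g ∈ Nᗮ) :
    (σ - 2 * ε) * ‖g‖ ^ 2 ≤ ⟪g, T g⟫ := by
  rcases eq_or_ne g 0 with rfl | hg0
  · simp
  have hdisj : Disjoint N (ℝ ∙ g) :=
    (Submodule.orthogonal_disjoint N).mono_right
      ((Submodule.span_singleton_le_iff_mem _ _).2 hg)
  have hdim : Module.finrank ℝ ↥(N ⊔ ℝ ∙ g) = Module.finrank ℝ N + 1 := by
    have h := Submodule.finrank_sup_add_finrank_inf_eq N (ℝ ∙ g)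
    rwa [hdisj.eq_bot, finrank_bot, finrank_span_singleton hg0, add_zero] at h
  have hmeet : ¬ Disjoint W (N ⊔ ℝ ∙ g) := fun h => by
    have h₁ := Submodule.finrank_add_finrank_le_of_disjoint h
    have h₂ := Submodule.finrank_le N
    omega
  rw [Submodule.disjoint_def] at hmeet
  push Not at hmeet
  obtain ⟨w, hwW, hw, hw0⟩ := hmeet
  obtain ⟨v, hv, u, hu, rfl⟩ := Submodule.mem_sup.1 hw
  obtain ⟨a, rfl⟩ := Submodule.mem_span_singleton.1 hu
  have horth : ⟪v, g⟫ = 0 := (Submodule.mem_orthogonal N g).1 hg v hv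
  have hform : ⟪v + a • g, T (v + a • g)⟫
      = ⟪v, T v⟫ + 2 * (a * ⟪g, T v⟫) + a ^ 2 * ⟪g, T g⟫ := by
    have h : ⟪v, T g⟫ = ⟪g, T v⟫ := by rw [← hT, real_inner_comm]
    simp only [map_add, map_smul, inner_add_left, inner_add_right, inner_smul_left,
      inner_smul_right, h, conj_trivial]
    ring
  have hnorm : ‖v + a • g‖ ^ 2 = ‖v‖ ^ 2 + a ^ 2 * ‖g‖ ^ 2 := by
    rw [norm_add_sq_real, inner_smul_right, horth, norm_smul, mul_pow, Real.norm_eq_abs, sq_abs]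
    ring
  have hvv : ⟪v, T v⟫ ≤ ε * ‖v‖ ^ 2 := by
    nlinarith [real_inner_le_norm v (T v), hN v hv, norm_nonneg v]
  have hgv : 2 * (a * ⟪g, T v⟫) ≤ ε * (‖v‖ ^ 2 + a ^ 2 * ‖g‖ ^ 2) := by
    have h₁ : a * ⟪g, T v⟫ ≤ (|a| * ‖g‖) * (ε * ‖v‖) := by
      calc a * ⟪g, T v⟫ ≤ |a| * |⟪g, T v⟫| := by rw [← abs_mul]; exact le_abs_self _
        _ ≤ |a| * (‖g‖ * ‖T v‖) := by gcongr; exact abs_real_inner_le_norm g (T v)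
        _ ≤ |a| * (‖g‖ * (ε * ‖v‖)) := by gcongr; exact hN v hv
        _ = _ := by ring
    have h₂ : 0 ≤ ε * (‖v‖ - |a| * ‖g‖) ^ 2 := by positivity
    rw [← sq_abs a]
    linarith [show ε * (‖v‖ - |a| * ‖g‖) ^ 2
      = ε * (‖v‖ ^ 2 + |a| ^ 2 * ‖g‖ ^ 2) - 2 * (|a| * ‖g‖ * (ε * ‖v‖)) by ring]
  have hlow := hlower _ hwW
  rw [hform, hnorm] at hlow
  have hpos : 0 < ‖v + a • g‖ ^ 2 := by positivity
  rw [hnorm] at hpos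
  have hkey : (σ - 2 * ε) * (‖v‖ ^ 2 + a ^ 2 * ‖g‖ ^ 2) ≤ a ^ 2 * ⟪g, T g⟫ := by
    nlinarith [mul_nonneg (mul_nonneg hε (sq_nonneg a)) (sq_nonneg ‖g‖)]
  have ha : 0 < a ^ 2 := by
    rcases eq_or_ne a 0 with rfl | ha
    · nlinarith [mul_pos (sub_pos.2 hεσ) hpos]
    · positivity
  have hv2 : 0 ≤ (σ - 2 * ε) * ‖v‖ ^ 2 := mul_nonneg (sub_pos.2 hεσ).le (sq_nonneg _)
  exact le_of_mul_le_mul_left (by linarith) ha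

/-- Pointwise convergence to zero of linear maps on a finite-dimensional subspace is uniform on
bounded sets. -/
theorem eventually_norm_apply_le_of_tendsto_zero {ι : Type*} {l : Filter ι} {T : ι → E →ₗ[ℝ] E}
    {N : Submodule ℝ E} [FiniteDimensional ℝ N]
    (hT : ∀ v ∈ N, Tendsto (fun k => T k v) l (𝓝 0)) {ε : ℝ} (hε : 0 < ε) :
    ∀ᶠ k in l, ∀ v ∈ N, ‖T k v‖ ≤ ε * ‖v‖ := by
  let b := stdOrthonormalBasis ℝ N
  have hsum : Tendsto (fun k => ∑ j, ‖T k (b j)‖) l (𝓝 0) := by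
    simpa using tendsto_finsetSum Finset.univ fun j _ => (hT (b j) (b j).2).norm
  filter_upwards [hsum.eventually_le_const hε] with k hk v hv
  have hrepr : v = ∑ j, ⟪b j, (⟨v, hv⟩ : N)⟫ • (b j : E) := by
    have h := congrArg Subtype.val (b.sum_repr' ⟨v, hv⟩)
    simpa using h.symm
  calc ‖T k v‖ = ‖∑ j, ⟪b j, (⟨v, hv⟩ : N)⟫ • T k (b j)‖ := by
        conv_lhs => rw [hrepr]
        simp only [map_sum, map_smul]
    _ ≤ ∑ j, ‖T k (b j)‖ * ‖v‖ := by
        refine norm_sum_le_of_le _ fun j _ => ?_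
        rw [norm_smul, mul_comm]
        gcongr
        simpa using norm_inner_le_norm (𝕜 := ℝ) (b j) (⟨v, hv⟩ : N)
    _ = (∑ j, ‖T k (b j)‖) * ‖v‖ := by rw [Finset.sum_mul]
    _ ≤ ε * ‖v‖ := by gcongr

end QuadraticForm

section Simplex

variable {E ι : Type*} [NormedAddCommGroup E] [NormedSpace ℝ E] [Fintype ι]

/-- If the origin is a strictly positive combination of affinely independent vectors, then for
all nearby families of vectors, an affine combination representing the origin is convex. -/
theorem AffineIndependent.eventually_zero_mem_convexHull {X : Type*} [TopologicalSpace X]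
    [Nonempty ι] {G : ι → X → E} {x₀ : X} (hG : ∀ i, ContinuousAt (G i) x₀)
    (hind : AffineIndependent ℝ fun i => G i x₀) {α : ι → ℝ} (hα : ∀ i, 0 < α i)
    (hzero : ∑ i, α i • G i x₀ = 0) :
    ∀ᶠ x in 𝓝 x₀, ∀ β : ι → ℝ, ∑ i, β i = 1 → ∑ i, β i • G i x = 0 →
      0 ∈ convexHull ℝ (Set.range fun i => G i x) := by
  wlog hone : ∑ i, α i = 1 generalizing α
  · have hpos : 0 < ∑ i, α i := Finset.sum_pos (fun i _ => hα i) Finset.univ_nonempty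
    refine this (α := fun i => (∑ j, α j)⁻¹ * α i) (fun i => mul_pos (inv_pos.2 hpos) (hα i)) ?_ ?_
    · simp only [mul_smul, ← Finset.smul_sum, hzero, smul_zero]
    · rw [← Finset.mul_sum, inv_mul_cancel₀ hpos.ne']
  let A : (ι → ℝ) →ₗ[ℝ] E × ℝ :=
    (Fintype.linearCombination ℝ fun i => G i x₀).prod (Fintype.linearCombination ℝ fun _ => 1)
  have hA : ∀ c, A c = (∑ i, c i • G i x₀, ∑ i, c i) := fun c => by
    simp [A, Fintype.linearCombination_apply]
  have hinj : Function.Injective A := by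
    rw [injective_iff_map_eq_zero]
    intro c hc
    rw [hA, Prod.mk_eq_zero] at hc
    exact funext fun i => affineIndependent_iff.1 hind Finset.univ c hc.2 hc.1 i (Finset.mem_univ i)
  obtain ⟨K, -, hK⟩ := A.injective_iff_antilipschitz.1 hinj
  have hS : Tendsto (fun x => ∑ i, ‖G i x₀ - G i x‖) (𝓝 x₀) (𝓝 0) := by
    have h := tendsto_finsetSum Finset.univ fun i _ =>
      ((tendsto_const_nhds (x := G i x₀)).sub (hG i).tendsto).norm
    simpa using h
  have hKS : Tendsto (fun x => K * ∑ i, ‖G i x₀ - G i x‖) (𝓝 x₀) (𝓝 0) := by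
    simpa using hS.const_mul (K : ℝ)
  have hKSα : Tendsto (fun x => 2 * (K * ∑ i, ‖G i x₀ - G i x‖) * ‖α‖) (𝓝 x₀) (𝓝 0) := by
    simpa using (hKS.const_mul 2).mul_const ‖α‖
  filter_upwards [hKS.eventually_le_const (by norm_num : (0 : ℝ) < 1 / 2),
    eventually_all.2 fun i => hKSα.eventually_le_const (hα i)] with x hx₁ hx₂ β hβ₁ hβ₀
  have hdiff : A (β - α) = (∑ i, β i • (G i x₀ - G i x), 0) := by
    rw [map_sub, hA, hA, hzero, hone, hβ₁]
    simp [smul_sub, hβ₀]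
  have hbound : ‖A (β - α)‖ ≤ (∑ i, ‖G i x₀ - G i x‖) * ‖β‖ := by
    rw [hdiff, Prod.norm_mk, norm_zero, max_eq_left (norm_nonneg _), Finset.sum_mul]
    refine norm_sum_le_of_le _ fun i _ => ?_
    rw [norm_smul, mul_comm]
    gcongr
    exact norm_le_pi_norm β i
  have hβα : ‖β‖ ≤ ‖α‖ + ‖β - α‖ := by
    simpa using norm_add_le α (β - α)
  have hdist : ‖β - α‖ ≤ 2 * (K * ∑ i, ‖G i x₀ - G i x‖) * ‖α‖ := by
    have h₁ : ‖β - α‖ ≤ K * ‖A (β - α)‖ := ZeroHomClass.bound_of_antilipschitz A hK (β - α)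
    have h₂ : ‖β - α‖ ≤ (K * ∑ i, ‖G i x₀ - G i x‖) * (‖α‖ + ‖β - α‖) :=
      calc ‖β - α‖ ≤ K * ‖A (β - α)‖ := h₁
        _ ≤ K * ((∑ i, ‖G i x₀ - G i x‖) * (‖α‖ + ‖β - α‖)) := by
          gcongr
          exact hbound.trans (by gcongr)
        _ = _ := by ring
    nlinarith [norm_nonneg (β - α)]
  rw [← hβ₀]
  refine (convex_convexHull ℝ _).sum_mem (fun i _ => ?_) hβ₁
    fun i _ => subset_convexHull ℝ _ ⟨i, rfl⟩
  have h := (abs_le.1 ((norm_le_pi_norm (β - α) i).trans hdist)).1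
  simp only [Pi.sub_apply] at h
  linarith [hx₂ i]

end Simplex

/-- Small strict sublevel sets of a continuous function with a unique global minimum and a
nontrivial bounded sublevel set are contained in a given neighborhood of the minimizer. -/
theorem exists_sublevel_subset_of_mem_nhds {E : Type*} [PseudoMetricSpace E] [ProperSpace E]
    {f : E → ℝ} (hf : Continuous f) {x₀ z : E} (hmin : ∀ x, x ≠ x₀ → f x₀ < f x) (hz : z ≠ x₀)
    (hbdd : Bornology.IsBounded {x | f x ≤ f z}) {V : Set E} (hV : V ∈ 𝓝 x₀) :
    ∃ c, f x₀ < c ∧ ∀ y, f y < c → y ∈ V := by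
  have hK : IsCompact ({x | f x ≤ f z} \ interior V) :=
    (Metric.isCompact_of_isClosed_isBounded (isClosed_le hf continuous_const) hbdd).diff
      isOpen_interior
  rcases ({x | f x ≤ f z} \ interior V).eq_empty_or_nonempty with hempty | hne
  · exact ⟨f z, hmin z hz, fun y hy => interior_subset (Set.sdiff_eq_empty.1 hempty hy.le)⟩
  · obtain ⟨y₀, hy₀, hy₀min⟩ := hK.exists_isMinOn hne hf.continuousOn
    have hy₀ne : y₀ ≠ x₀ := fun h => hy₀.2 (h ▸ mem_interior_iff_mem_nhds.2 hV)
    refine ⟨min (f z) (f y₀), lt_min (hmin z hz) (hmin y₀ hy₀ne), fun y hy => ?_⟩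
    by_contra hyV
    exact (hy.trans_le (min_le_right _ _)).not_ge
      (hy₀min ⟨(hy.trans_le (min_le_left _ _)).le, fun h => hyV (interior_subset h)⟩)

section Curvature

variable {E ι : Type*} [NormedAddCommGroup E] [InnerProductSpace ℝ E] [Fintype ι]

/-- Uniformly bounded operators which vanish asymptotically on the differences `a i - g₀` also
vanish asymptotically on `u (j k) k - g₀` whenever `u i` converges to `a i`. -/
theorem tendsto_apply_sub_of_tendsto {T : ℕ → E →ₗ[ℝ] E} {σ : ℝ}
    (hbound : ∀ k v, ‖T k v‖ ≤ σ * ‖v‖) {a : ι → E} {g₀ : E}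
    (ha : ∀ i, Tendsto (fun k => T k (a i - g₀)) atTop (𝓝 0)) {u : ι → ℕ → E}
    (hu : ∀ i, Tendsto (u i) atTop (𝓝 (a i))) (j : ℕ → ι) :
    Tendsto (fun k => T k (u (j k) k - g₀)) atTop (𝓝 0) := by
  have hmain : ∀ i, Tendsto (fun k => T k (u i k - g₀)) atTop (𝓝 0) := fun i => by
    have hdiff : Tendsto (fun k => T k (u i k - a i)) atTop (𝓝 0) := by
      refine squeeze_zero_norm (fun k => hbound k _) ?_
      simpa using ((hu i).sub_const (a i)).norm.const_mul σ
    simpa [← map_add] using hdiff.add (ha i)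
  refine squeeze_zero_norm (a := fun k => ∑ i, ‖T k (u i k - g₀)‖) (fun k => ?_) ?_
  · exact Finset.single_le_sum (f := fun i => ‖T k (u i k - g₀)‖)
      (fun i _ => norm_nonneg _) (Finset.mem_univ (j k))
  · simpa using tendsto_finsetSum Finset.univ fun i _ => (hmain i).norm

/-- If positive operators degenerate exactly along `N`, and the curvature inequality holds for
vectors accumulating at points of `g₀ + N` with `g₀` orthogonal to `N`, then `g₀ = 0`. -/
theorem eq_zero_of_curvature_condition [FiniteDimensional ℝ E] {T : ℕ → E →ₗ[ℝ] E}
    (hT : ∀ k, (T k).IsPositive) {σL σU c : ℝ} (hσL : 0 < σL) (hσU : 0 < σU) (hc : c < 1)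
    (hupper : ∀ k v, ⟪v, T k v⟫ ≤ σU * ‖v‖ ^ 2) {N : Submodule ℝ E}
    (hlower : ∀ k, ∃ W : Submodule ℝ E,
      Module.finrank ℝ W = Module.finrank ℝ E - Module.finrank ℝ N ∧
      ∀ w ∈ W, σL * ‖w‖ ^ 2 ≤ ⟪w, T k w⟫)
    (hN : ∀ v ∈ N, Tendsto (fun k => T k v) atTop (𝓝 0))
    {a : ι → E} {g₀ : E} (hg₀ : g₀ ∈ Nᗮ) (ha : ∀ i, a i - g₀ ∈ N) {u w : ι → ℕ → E}
    (hu : ∀ i, Tendsto (u i) atTop (𝓝 (a i))) (hw : ∀ i, Tendsto (w i) atTop (𝓝 (a i)))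
    {i j : ℕ → ι}
    (hcurv : ∀ k, ⟪w (j k) k, T k (u (i k) k)⟫ ≤ c * ⟪u (i k) k, T k (u (i k) k)⟫) :
    g₀ = 0 := by
  have hbound : ∀ k v, ‖T k v‖ ≤ σU * ‖v‖ := fun k => (hT k).norm_apply_le hσU (hupper k)
  have hTu := tendsto_apply_sub_of_tendsto hbound (fun l => hN _ (ha l)) hu i
  have hTw := tendsto_apply_sub_of_tendsto hbound (fun l => hN _ (ha l)) hw j
  have hnorm : Tendsto (fun k => ∑ l, ‖u l k‖) atTop (𝓝 (∑ l, ‖a l‖)) :=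
    tendsto_finsetSum Finset.univ fun l _ => (hu l).norm
  have hle : ∀ k, ‖u (i k) k‖ ≤ ∑ l, ‖u l k‖ := fun k =>
    Finset.single_le_sum (f := fun l => ‖u l k‖) (fun l _ => norm_nonneg _)
      (Finset.mem_univ (i k))
  have hinner : ∀ r : ℕ → E, Tendsto r atTop (𝓝 0) →
      Tendsto (fun k => ⟪r k, u (i k) k⟫) atTop (𝓝 0) := fun r hr => by
    refine squeeze_zero_norm (a := fun k => ‖r k‖ * ∑ l, ‖u l k‖) (fun k => ?_) ?_
    · exact (norm_inner_le_norm _ _).trans (by gcongr; exact hle k)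
    · simpa using hr.norm.mul hnorm
  have h₁ := hinner _ hTu
  have h₂ := hinner _ hTw
  have h₃ : Tendsto (fun k => ⟪T k (u (i k) k - g₀), g₀⟫) atTop (𝓝 0) := by
    simpa using hTu.inner (tendsto_const_nhds (x := g₀))
  have hlim := (((h₁.add h₃).const_mul (-(1 - c))).add h₁).sub h₂
  simp only [add_zero, mul_zero, sub_zero] at hlim
  have hev := eventually_norm_apply_le_of_tendsto_zero hN (by positivity : 0 < σL / 4)
  have hfin : (1 - c) * (σL / 2 * ‖g₀‖ ^ 2) ≤ 0 := by
    refine ge_of_tendsto hlim ?_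
    filter_upwards [hev] with k hk
    obtain ⟨W, hW, hWlow⟩ := hlower k
    have hsymm := (hT k).isSymmetric
    have hg := hsymm.le_inner_apply_of_mem_orthogonal hW hWlow
      (by positivity) (by linarith) hk hg₀
    have hkc := hcurv k
    have e₁ : ⟪T k (u (i k) k - g₀), u (i k) k⟫
        = ⟪u (i k) k, T k (u (i k) k)⟫ - ⟪g₀, T k (u (i k) k)⟫ := by
      rw [hsymm, inner_sub_left]
    have e₂ : ⟪T k (w (j k) k - g₀), u (i k) k⟫
        = ⟪w (j k) k, T k (u (i k) k)⟫ - ⟪g₀, T k (u (i k) k)⟫ := by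
      rw [hsymm, inner_sub_left]
    have e₃ : ⟪T k (u (i k) k - g₀), g₀⟫ = ⟪g₀, T k (u (i k) k)⟫ - ⟪g₀, T k g₀⟫ := by
      rw [real_inner_comm, map_sub, inner_sub_right]
    rw [e₁, e₂, e₃]
    nlinarith [mul_le_mul_of_nonneg_left hg (sub_pos.2 hc).le]
  by_contra hne
  have : 0 < (1 - c) * (σL / 2 * ‖g₀‖ ^ 2) := by
    have := sub_pos.2 hc
    positivity
  linarith

end Curvature

/-- Every selection function that is essentially active along infinitely many terms of a convergent
sequence is essentially active at the limit. -/
theorem mem_Ie_of_tendsto {n m : ℕ} {f : Euc n → ℝ} {φ : Fin m → Euc n → ℝ} {x : ℕ → Euc n}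
    {xbar : Euc n} (hx : Tendsto x atTop (𝓝 xbar)) {i : Fin m}
    (hi : {k | i ∈ Ie f φ (x k)}.Infinite) : i ∈ Ie f φ xbar :=
  isClosed_closure.mem_of_frequently_of_tendsto (Nat.frequently_atTop_iff_infinite.2 hi) hx

/-- Under Behavior (B1) the affine hull of the limiting gradients contains the origin. -/
theorem B1.gradient_mem_NSpace {n m : ℕ} [NeZero m] {f : Euc n → ℝ} {φ : Fin m → Euc n → ℝ}
    (hA1 : A1 f φ) {c1 c2 : ℝ} {x : ℕ → Euc n} {H : ℕ → Matrix (Fin n) (Fin n) ℝ} {t : ℕ → ℝ}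
    {xbar : Euc n} (hB1 : B1 f φ c1 c2 x H t xbar) :
    gradient (φ 0) xbar ∈ NSpace φ xbar := by
  obtain ⟨-, hsel, hφ⟩ := hA1
  obtain ⟨⟨-, -, hc2⟩, hH, hstep, hwolfe, hdiff, hlim, -, ⟨σL, σU, hσL, hσLU, hbounds⟩, hnull⟩ :=
    hB1
  set N := NSpace φ xbar
  have hgen : ∀ i, gradient (φ i) xbar - gradient (φ 0) xbar ∈ N :=
    fun i => Submodule.subset_span ⟨i, rfl⟩
  choose i hi using fun k => exists_gradient_eq_of_selection hsel (hdiff k).1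
    fun j => (hφ j).1.differentiable one_ne_zero (x k)
  have hcont : ∀ j, Tendsto (fun k => gradient (φ j) (x k)) atTop (𝓝 (gradient (φ j) xbar)) :=
    fun j => ((hφ j).2.continuous.tendsto xbar).comp hlim
  have hzero := eq_zero_of_curvature_condition (T := fun k => Matrix.toEuclideanLin (H k))
    (N := N) (a := fun j => gradient (φ j) xbar)
    (g₀ := gradient (φ 0) xbar - N.starProjection (gradient (φ 0) xbar))
    (u := fun j k => gradient (φ j) (x k)) (w := fun j k => gradient (φ j) (x (k + 1)))
    (i := i) (j := fun k => i (k + 1))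
    (fun k => Matrix.isPositive_toEuclideanLin_iff.2 (hH k).2.posSemidef)
    hσL (hσL.trans_le hσLU) hc2 (fun k => (hbounds k).1)
    (fun k => by simpa using (hbounds k).2) ?_
    (Submodule.sub_starProjection_mem_orthogonal _) ?_ hcont
    (fun j => (hcont j).comp (tendsto_add_atTop_nat 1)) ?_
  · rw [sub_eq_zero.1 hzero]
    exact Submodule.starProjection_apply_mem _ _
  · intro v hv
    refine Submodule.span_induction ?_ ?_ ?_ ?_ hv
    · rintro _ ⟨j, rfl⟩
      exact hnull j
    · simp
    · intro v w _ _ hv hw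
      simpa using hv.add hw
    · intro a v _ hv
      simpa using hv.const_smul a
  · intro j
    rw [sub_sub_eq_add_sub, add_sub_right_comm]
    exact N.add_mem (hgen j) (Submodule.starProjection_apply_mem _ _)
  · intro k
    have h := (hwolfe k).2.2.2
    rw [← hstep k, hi k, hi (k + 1), inner_neg_right, inner_neg_right] at h
    linarith

/-- Under Behavior (B1) the value of `f` at the limit is at most its initial value. -/
theorem B1.apply_limit_le {n m : ℕ} [NeZero m] {f : Euc n → ℝ} {φ : Fin m → Euc n → ℝ}
    (hf : Continuous f) {c1 c2 : ℝ} {x : ℕ → Euc n} {H : ℕ → Matrix (Fin n) (Fin n) ℝ}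
    {t : ℕ → ℝ} {xbar : Euc n} (hB1 : B1 f φ c1 c2 x H t xbar) : f xbar ≤ f (x 0) := by
  obtain ⟨⟨hc1, -, -⟩, hH, hstep, hwolfe, -, hlim, -⟩ := hB1
  have hanti : Antitone fun k => f (x k) := antitone_nat_of_succ_le fun k => by
    have hpos : 0 ≤ ⟪gradient f (x k), Matrix.toEuclideanLin (H k) (gradient f (x k))⟫ := by
      simpa using (Matrix.isPositive_toEuclideanLin_iff.2
        (hH k).2.posSemidef).re_inner_nonneg_right (gradient f (x k))
    have h := (hwolfe k).2.2.1
    rw [← hstep k, inner_neg_right] at h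
    nlinarith [mul_nonneg (mul_pos hc1 (hwolfe k).1).le hpos]
  exact le_of_tendsto ((hf.tendsto xbar).comp hlim) (Eventually.of_forall fun k =>
    hanti (Nat.zero_le k))

/-- If `∇φ₀(x)` lies in the space of gradient differences, then the origin is an affine combination
of the gradients. -/
theorem exists_affine_combination_eq_zero {n m : ℕ} [NeZero m] {φ : Fin m → Euc n → ℝ} {x : Euc n}
    (h : gradient (φ 0) x ∈ NSpace φ x) :
    ∃ β : Fin m → ℝ, ∑ i, β i = 1 ∧ ∑ i, β i • gradient (φ i) x = 0 := by
  obtain ⟨c, hc⟩ := (Submodule.mem_span_range_iff_exists_fun ℝ).1 h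
  refine ⟨Pi.single 0 (1 + ∑ i, c i) - c, by simp, ?_⟩
  simp only [smul_sub, Finset.sum_sub_distrib, ← Finset.sum_smul] at hc
  simp only [Pi.sub_apply, sub_smul, Finset.sum_sub_distrib, Pi.single_apply, ite_smul, zero_smul,
    Finset.sum_ite_eq', Finset.mem_univ, if_true, add_smul, one_smul]
  rw [sub_eq_iff_eq_add.1 hc]
  abel

/-- Theorem `thm:criticality`: under (A2), there is a neighborhood `U` of
`x*` such that whenever Behavior (B1) holds with `x^0 ∈ U`, the limit `x̄` is a Clarke
critical point of `f`. -/
theorem criticality {n m : ℕ} [NeZero m] (f : Euc n → ℝ) (φ : Fin m → Euc n → ℝ)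
    (xstar : Euc n) (hA1 : A1 f φ) (hA21 : A21 φ xstar) (hA22 : A22 f xstar) :
    ∃ U : Set (Euc n), IsOpen U ∧ xstar ∈ U ∧
      ∀ (c1 c2 : ℝ) (x : ℕ → Euc n) (H : ℕ → Matrix (Fin n) (Fin n) ℝ) (t : ℕ → ℝ)
        (xbar : Euc n), x 0 ∈ U → B1 f φ c1 c2 x H t xbar →
          0 ∈ convexHull ℝ ((fun i : Fin m => gradient (φ i) xbar) '' Ie f φ xbar) := by
  obtain ⟨⟨α, hα, hzero⟩, hind⟩ := hA21
  obtain ⟨hmin, z, hz, hbdd⟩ := hA22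
  obtain ⟨c, hc, hsub⟩ := exists_sublevel_subset_of_mem_nhds hA1.1 hmin hz hbdd
    (hind.eventually_zero_mem_convexHull (G := fun i => gradient (φ i))
      (fun i => (hA1.2.2 i).2.continuous.continuousAt) hα hzero)
  refine ⟨{x | f x < c}, isOpen_lt hA1.1 continuous_const, hc, ?_⟩
  intro c1 c2 x H t xbar hx0 hB1
  obtain ⟨β, hβ₁, hβ₀⟩ := exists_affine_combination_eq_zero (hB1.gradient_mem_NSpace hA1)
  have hIe : Ie f φ xbar = Set.univ := Set.eq_univ_of_forall fun i => by
    obtain ⟨-, -, -, -, -, hlim, hinf, -⟩ := hB1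
    exact mem_Ie_of_tendsto hlim ((hinf i).mono fun k hk => hk.1)
  rw [hIe, Set.image_univ]
  exact hsub xbar ((hB1.apply_limit_le hA1.1).trans_lt hx0) β hβ₁ hβ₀
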